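/- Let Ṽ : B(S^{n-1})₊ → ℝ be a radial continuous valuation arising as the unique continuous extension of a radial continuous valuation on star bodies (continuous radial functions). Then Ṽ is uniformly continuous on bounded sets: for every λ > 0 and ε > 0 there is δ > 0 such that whenever f, g ∈ B(S^{n-1})₊ satisfy ‖f‖_∞, ‖g‖_∞ ≤ λ and ‖f − g‖_∞ ≤ δ, then |Ṽ(f) − Ṽ(g)| ≤ ε. -/

import Mathlib

open MeasureTheory Filter Topology

/-- The cone `B(S^{n-1})₊` of bounded nonnegative Borel functions on the sphere. -/
def BddBorelNN {n : ℕ} (f : Metric.sphere (0 : EuclideanSpace ℝ (Fin n)) 1 → ℝ) : Prop :=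
  Measurable f ∧ (∃ C : ℝ, ∀ t, f t ≤ C) ∧ ∀ t, 0 ≤ f t

/-- A pair of functions in `B(S^{n-1})₊` with values in the cells `[a, a + r]`, at uniform distance
at most `δ`. -/
structure ClosePair {n : ℕ} (a : Metric.sphere (0 : EuclideanSpace ℝ (Fin n)) 1 → ℝ) (r δ : ℝ)
    (h k : Metric.sphere (0 : EuclideanSpace ℝ (Fin n)) 1 → ℝ) : Prop where
  left : BddBorelNN h
  right : BddBorelNN k
  left_mem : ∀ t, a t ≤ h t ∧ h t ≤ a t + r
  right_mem : ∀ t, a t ≤ k t ∧ k t ≤ a t + r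
  dist_le : ∀ t, |h t - k t| ≤ δ

section Valuation

variable {n : ℕ}

theorem bddBorelNN_const {c : ℝ} (hc : 0 ≤ c) :
    BddBorelNN (fun _ : Metric.sphere (0 : EuclideanSpace ℝ (Fin n)) 1 => c) :=
  ⟨measurable_const, ⟨c, fun _ => le_rfl⟩, fun _ => hc⟩

open Classical in
theorem BddBorelNN.piecewise {u v : Metric.sphere (0 : EuclideanSpace ℝ (Fin n)) 1 → ℝ}
    (hu : BddBorelNN u) (hv : BddBorelNN v)
    {B : Set (Metric.sphere (0 : EuclideanSpace ℝ (Fin n)) 1)} (hB : MeasurableSet B) :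
    BddBorelNN (B.piecewise u v) := by
  obtain ⟨hum, ⟨C, hC⟩, hu0⟩ := hu
  obtain ⟨hvm, ⟨D, hD⟩, hv0⟩ := hv
  refine ⟨hum.piecewise hB hvm, ⟨max C D, fun t => ?_⟩, fun t => ?_⟩
  · by_cases ht : t ∈ B
    · simpa [ht] using Or.inl (hC t)
    · simpa [ht] using Or.inr (hD t)
  · by_cases ht : t ∈ B
    · simpa [ht] using hu0 t
    · simpa [ht] using hv0 t

open Classical in
/-- A valuation splits as a sum along a Borel set and its complement. -/
theorem valuation_piecewise
    {V : (Metric.sphere (0 : EuclideanSpace ℝ (Fin n)) 1 → ℝ) → ℝ}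
    (hval : ∀ f g, BddBorelNN f → BddBorelNN g →
      V (fun t => max (f t) (g t)) + V (fun t => min (f t) (g t)) = V f + V g)
    {B : Set (Metric.sphere (0 : EuclideanSpace ℝ (Fin n)) 1)} (hB : MeasurableSet B) :
    ∃ X Y : (Metric.sphere (0 : EuclideanSpace ℝ (Fin n)) 1 → ℝ) → ℝ,
      ∀ u v, BddBorelNN u → BddBorelNN v → V (B.piecewise u v) = X u + Y v := by
  refine ⟨fun u => V (B.piecewise u fun _ => 0),
    fun v => V (B.piecewise (fun _ => 0) v) - V fun _ => 0, fun u v hu hv => ?_⟩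
  have h0 := bddBorelNN_const (n := n) le_rfl
  have key := hval _ _ (hu.piecewise h0 hB) (h0.piecewise hv hB)
  have hmax : (fun t => max (B.piecewise u (fun _ => 0) t) (B.piecewise (fun _ => 0) v t))
      = B.piecewise u v := by
    funext t
    by_cases ht : t ∈ B
    · simpa [ht] using hu.2.2 t
    · simpa [ht] using hv.2.2 t
  have hmin : (fun t => min (B.piecewise u (fun _ => 0) t) (B.piecewise (fun _ => 0) v t))
      = fun _ => 0 := by
    funext t
    by_cases ht : t ∈ B
    · simpa [ht] using hu.2.2 t
    · simpa [ht] using hv.2.2 t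
  rw [hmax, hmin] at key
  linarith

open Classical in
theorem ClosePair.piecewise {a b h k p q : Metric.sphere (0 : EuclideanSpace ℝ (Fin n)) 1 → ℝ}
    {r δ : ℝ} {B : Set (Metric.sphere (0 : EuclideanSpace ℝ (Fin n)) 1)} (hB : MeasurableSet B)
    (hh : BddBorelNN h) (hk : BddBorelNN k) (hp : BddBorelNN p) (hq : BddBorelNN q)
    (hin : ∀ t ∈ B, (a t ≤ h t ∧ h t ≤ a t + r) ∧ (a t ≤ k t ∧ k t ≤ a t + r) ∧
      |h t - k t| ≤ δ)
    (hout : ∀ t ∉ B, (b t ≤ p t ∧ p t ≤ b t + r) ∧ (b t ≤ q t ∧ q t ≤ b t + r) ∧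
      |p t - q t| ≤ δ) :
    ClosePair (B.piecewise a b) r δ (B.piecewise h p) (B.piecewise k q) := by
  refine ⟨hh.piecewise hp hB, hk.piecewise hq hB, fun t => ?_, fun t => ?_, fun t => ?_⟩ <;>
    by_cases ht : t ∈ B
  · simpa [ht] using (hin t ht).1
  · simpa [ht] using (hout t ht).1
  · simpa [ht] using (hin t ht).2.1
  · simpa [ht] using (hout t ht).2.1
  · simpa [ht] using (hin t ht).2.2
  · simpa [ht] using (hout t ht).2.2

open Classical in
/-- A continuous valuation is bounded on bounded sets. -/
theorem valuation_bounded
    {V : (Metric.sphere (0 : EuclideanSpace ℝ (Fin n)) 1 → ℝ) → ℝ}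
    (hval : ∀ f g, BddBorelNN f → BddBorelNN g →
      V (fun t => max (f t) (g t)) + V (fun t => min (f t) (g t)) = V f + V g)
    (hcont : ∀ f, BddBorelNN f → ∀ ε > (0:ℝ), ∃ δ > (0:ℝ), ∀ g, BddBorelNN g →
      (∀ t, |f t - g t| ≤ δ) → |V f - V g| ≤ ε)
    {lam : ℝ} (hlam : 0 ≤ lam) :
    ∃ C, ∀ f, BddBorelNN f → (∀ t, f t ≤ lam) → |V f| ≤ C := by
  set T : Set ℝ := {a | 0 ≤ a ∧ a ≤ lam ∧ ∃ C, ∀ f, BddBorelNN f → (∀ t, f t ≤ a) → |V f| ≤ C}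
  have h0T : (0 : ℝ) ∈ T := by
    refine ⟨le_rfl, hlam, |V fun _ => 0|, fun f hf hf0 => ?_⟩
    rw [show f = fun _ => 0 from funext fun t => le_antisymm (hf0 t) (hf.2.2 t)]
  have hbdd : BddAbove T := ⟨lam, fun a ha => ha.2.1⟩
  have hs0 : 0 ≤ sSup T := le_csSup hbdd h0T
  obtain ⟨δ, hδ, hV⟩ := hcont _ (bddBorelNN_const (n := n) hs0) 1 one_pos
  obtain ⟨a, haT, has⟩ := exists_lt_of_lt_csSup ⟨0, h0T⟩ (sub_lt_self (sSup T) hδ)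
  have hle : a ≤ sSup T := le_csSup hbdd haT
  obtain ⟨ha0, -, C, hC⟩ := haT
  have hmem : min (sSup T + δ) lam ∈ T := by
    refine ⟨le_min (by linarith) hlam, min_le_right _ _, 3 * C + 2, fun f hf hfs => ?_⟩
    have hB : MeasurableSet {t | a ≤ f t} := measurableSet_le measurable_const hf.1
    obtain ⟨X, Y, hXY⟩ := valuation_piecewise hval hB
    have hac := bddBorelNN_const (n := n) ha0
    have hz := bddBorelNN_const (n := n) le_rfl
    have e1 := hXY f f hf hf
    have e2 := hXY f _ hf hac
    have e3 := hXY _ _ hac hac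
    have e4 := hXY _ _ hac hf
    rw [Set.piecewise_same] at e1 e3
    have b1 := hV _ hac fun t => abs_le.2 ⟨by linarith, by linarith⟩
    have b2 := hV _ (hf.piecewise hac hB) fun t => by
      by_cases ht : a ≤ f t
      · have := (hfs t).trans (min_le_left _ _)
        simp only [Set.piecewise, Set.mem_ofPred_eq, ht, if_true]
        exact abs_le.2 ⟨by linarith, by linarith⟩
      · simp only [Set.piecewise, Set.mem_ofPred_eq, ht, if_false]
        exact abs_le.2 ⟨by linarith, by linarith⟩
    have b3 := hC _ hac fun _ => le_rfl
    have b4 := hC _ (hac.piecewise hf hB) fun t => by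
      by_cases ht : a ≤ f t
      · simp [Set.piecewise, ht]
      · simpa [Set.piecewise, ht] using (not_le.1 ht).le
    have hC0 : 0 ≤ C := (abs_nonneg _).trans b3
    rw [abs_le] at b1 b2 b3 b4 ⊢
    constructor <;> linarith
  have hsl : lam ≤ sSup T := by
    by_contra! hlt
    have h1 := le_csSup hbdd hmem
    rcases min_le_iff.1 h1 with h | h <;> linarith
  have : min (sSup T + δ) lam = lam := min_eq_right (by linarith)
  rw [this] at hmem
  exact hmem.2.2

/-- For pairs in a fixed cell that are close enough, the oscillation of `V` is nearly attained by
pairs that are arbitrarily close. -/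
theorem exists_almost_maximal_closePair
    {V : (Metric.sphere (0 : EuclideanSpace ℝ (Fin n)) 1 → ℝ) → ℝ} {lam C : ℝ}
    (hC : ∀ f, BddBorelNN f → (∀ t, f t ≤ lam) → |V f| ≤ C)
    {a : Metric.sphere (0 : EuclideanSpace ℝ (Fin n)) 1 → ℝ} {r η : ℝ}
    (ha : Measurable a) (ha0 : ∀ t, 0 ≤ a t) (hr : 0 ≤ r) (har : ∀ t, a t + r ≤ lam)
    (hη : 0 < η) :
    ∃ δ₀ > (0 : ℝ), ∀ δ > (0 : ℝ), ∃ p q, ClosePair a r δ p q ∧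
      ∀ h k, ClosePair a r δ₀ h k → V h - V k ≤ V p - V q + η := by
  let D : ℝ → Set ℝ := fun δ => {x | ∃ h k, ClosePair a r δ h k ∧ V h - V k = x}
  have hD0 : ∀ δ > (0 : ℝ), (0 : ℝ) ∈ D δ := fun δ hδ => by
    have hab : BddBorelNN a := ⟨ha, ⟨lam, fun t => by linarith [har t]⟩, ha0⟩
    exact ⟨a, a, ⟨hab, hab, fun t => ⟨le_rfl, by linarith⟩, fun t => ⟨le_rfl, by linarith⟩,
      fun t => by simpa using hδ.le⟩, sub_self _⟩
  have hDb : ∀ δ, BddAbove (D δ) := fun δ => by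
    refine ⟨2 * C, ?_⟩
    rintro x ⟨h, k, hp, rfl⟩
    have b1 := abs_le.1 (hC h hp.left fun t => (hp.left_mem t).2.trans (har t))
    have b2 := abs_le.1 (hC k hp.right fun t => (hp.right_mem t).2.trans (har t))
    linarith
  let O : Set ℝ := (fun δ => sSup (D δ)) '' Set.Ioi 0
  have hOb : BddBelow O := by
    refine ⟨0, ?_⟩
    rintro x ⟨δ, hδ, rfl⟩
    exact le_csSup (hDb δ) (hD0 δ hδ)
  have hOn : O.Nonempty := ⟨_, 1, Set.mem_Ioi.2 one_pos, rfl⟩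
  obtain ⟨_, ⟨δ₀, hδ₀, rfl⟩, hlt⟩ :=
    exists_lt_of_csInf_lt hOn (show sInf O < sInf O + η / 2 by linarith)
  refine ⟨δ₀, hδ₀, fun δ hδ => ?_⟩
  have hO : sInf O ≤ sSup (D δ) := csInf_le hOb ⟨δ, hδ, rfl⟩
  obtain ⟨_, ⟨p, q, hpq, rfl⟩, hlt'⟩ :=
    exists_lt_of_lt_csSup ⟨0, hD0 δ hδ⟩ (show sSup (D δ) - η / 2 < sSup (D δ) by linarith)
  refine ⟨p, q, hpq, fun h k hhk => ?_⟩
  have := le_csSup (hDb δ₀) ⟨h, k, hhk, rfl⟩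
  simp only at hlt
  linarith

open Classical in
/-- Oscillation of `V` on a field of cells survives, up to `η`, on a field of cells that are shorter
by the factor `2 / 3`. -/
theorem exists_smaller_cells
    {V : (Metric.sphere (0 : EuclideanSpace ℝ (Fin n)) 1 → ℝ) → ℝ} {lam C : ℝ}
    (hval : ∀ f g, BddBorelNN f → BddBorelNN g →
      V (fun t => max (f t) (g t)) + V (fun t => min (f t) (g t)) = V f + V g)
    (hC : ∀ f, BddBorelNN f → (∀ t, f t ≤ lam) → |V f| ≤ C)
    {a : Metric.sphere (0 : EuclideanSpace ℝ (Fin n)) 1 → ℝ} {r η E : ℝ}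
    (ha : Measurable a) (ha0 : ∀ t, 0 ≤ a t) (hr : 0 < r) (har : ∀ t, a t + r ≤ lam)
    (hη : 0 < η) (hE : ∀ δ > (0 : ℝ), ∃ h k, ClosePair a r δ h k ∧ E ≤ V h - V k) :
    ∃ b, Measurable b ∧ (∀ t, a t ≤ b t) ∧ (∀ t, b t + 2 / 3 * r ≤ a t + r) ∧
      ∀ δ > (0 : ℝ), ∃ h k, ClosePair b (2 / 3 * r) δ h k ∧ E - η ≤ V h - V k := by
  have ha' : Measurable fun t => a t + r / 3 := ha.add_const _
  obtain ⟨δ₁, hδ₁, H₁⟩ := exists_almost_maximal_closePair hC (r := 2 / 3 * r) ha ha0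
    (by linarith) (fun t => by linarith [har t]) (half_pos hη)
  obtain ⟨δ₂, hδ₂, H₂⟩ := exists_almost_maximal_closePair hC (r := 2 / 3 * r) ha'
    (fun t => by linarith [ha0 t]) (by linarith) (fun t => by linarith [har t]) (half_pos hη)
  obtain ⟨h, k, hhk, hEhk⟩ := hE (min (r / 3) (min δ₁ δ₂))
    (lt_min (by linarith) (lt_min hδ₁ hδ₂))
  have d0 t := (hhk.dist_le t).trans (min_le_left _ _)
  have d1 t := (hhk.dist_le t).trans ((min_le_right _ _).trans (min_le_left _ _))
  have d2 t := (hhk.dist_le t).trans ((min_le_right _ _).trans (min_le_right _ _))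
  set B := {t | a t + r / 3 ≤ min (h t) (k t)}
  have hB : MeasurableSet B := measurableSet_le ha' (hhk.left.1.min hhk.right.1)
  have hin : ∀ t ∈ B, (a t + r / 3 ≤ h t ∧ h t ≤ a t + r / 3 + 2 / 3 * r) ∧
      (a t + r / 3 ≤ k t ∧ k t ≤ a t + r / 3 + 2 / 3 * r) ∧ |h t - k t| ≤ δ₂ := fun t ht => by
    have : a t + r / 3 ≤ h t ∧ a t + r / 3 ≤ k t := le_min_iff.1 (show _ ≤ min (h t) (k t) from ht)
    have h1 := hhk.left_mem t
    have h2 := hhk.right_mem t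
    exact ⟨⟨this.1, by linarith⟩, ⟨this.2, by linarith⟩, d2 t⟩
  have hout : ∀ t ∉ B, (a t ≤ h t ∧ h t ≤ a t + 2 / 3 * r) ∧
      (a t ≤ k t ∧ k t ≤ a t + 2 / 3 * r) ∧ |h t - k t| ≤ δ₁ := fun t ht => by
    have h1 := hhk.left_mem t
    have h2 := hhk.right_mem t
    have h3 := abs_le.1 (d0 t)
    have h4 : min (h t) (k t) < a t + r / 3 := not_le.1 ht
    refine ⟨⟨h1.1, ?_⟩, ⟨h2.1, ?_⟩, d1 t⟩ <;> rcases min_lt_iff.1 h4 with h | h <;> linarith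
  obtain ⟨X, Y, hXY⟩ := valuation_piecewise hval hB
  have hV : ∀ u, BddBorelNN u → V u = X u + Y u := fun u hu => by
    rw [← hXY u u hu hu, Set.piecewise_same]
  refine ⟨B.piecewise (fun t => a t + r / 3) a, ha'.piecewise hB ha, fun t => ?_, fun t => ?_,
    fun δ hδ => ?_⟩
  · by_cases ht : t ∈ B
    · simp only [Set.piecewise_eq_of_mem _ _ _ ht]
      linarith
    · simp only [Set.piecewise_eq_of_notMem _ _ _ ht]
      exact le_rfl
  · by_cases ht : t ∈ B
    · simp only [Set.piecewise_eq_of_mem _ _ _ ht]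
      linarith
    · simp only [Set.piecewise_eq_of_notMem _ _ _ ht]
      linarith
  obtain ⟨p, q, hpq, M₁⟩ := H₁ (min δ δ₁) (lt_min hδ hδ₁)
  obtain ⟨u, v, huv, M₂⟩ := H₂ (min δ δ₂) (lt_min hδ hδ₂)
  refine ⟨_, _, ClosePair.piecewise hB huv.left huv.right hpq.left hpq.right
    (fun t _ => ⟨huv.left_mem t, huv.right_mem t, (huv.dist_le t).trans (min_le_left _ _)⟩)
    (fun t _ => ⟨hpq.left_mem t, hpq.right_mem t, (hpq.dist_le t).trans (min_le_left _ _)⟩), ?_⟩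
  have P₁ := ClosePair.piecewise hB hpq.left hpq.right hhk.left hhk.right
    (fun t _ => ⟨hpq.left_mem t, hpq.right_mem t, (hpq.dist_le t).trans (min_le_right _ _)⟩) hout
  have P₂ := ClosePair.piecewise hB hhk.left hhk.right huv.left huv.right hin
    (fun t _ => ⟨huv.left_mem t, huv.right_mem t, (huv.dist_le t).trans (min_le_right _ _)⟩)
  rw [Set.piecewise_same] at P₁ P₂
  have N₁ := M₁ _ _ P₁
  have N₂ := M₂ _ _ P₂
  rw [hXY _ _ hpq.left hhk.left, hXY _ _ hpq.right hhk.right, hV _ hpq.left,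
    hV _ hpq.right] at N₁
  rw [hXY _ _ hhk.left huv.left, hXY _ _ hhk.right huv.right, hV _ huv.left,
    hV _ huv.right] at N₂
  rw [hV _ hhk.left, hV _ hhk.right] at hEhk
  rw [hXY _ _ huv.left hpq.left, hXY _ _ huv.right hpq.right]
  linarith

end Valuation

/-- Main technical theorem: a radial continuous valuation on the bounded Borel star sets
(i.e. on the cone `B(S^{n-1})₊` with the supremum norm) is uniformly continuous on
bounded sets. -/
theorem stmt17 {n : ℕ}
    (V : (Metric.sphere (0 : EuclideanSpace ℝ (Fin n)) 1 → ℝ) → ℝ)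
    (hval : ∀ f g, BddBorelNN f → BddBorelNN g →
      V (fun t => max (f t) (g t)) + V (fun t => min (f t) (g t)) = V f + V g)
    (hcont : ∀ f, BddBorelNN f → ∀ ε > (0:ℝ), ∃ δ > (0:ℝ), ∀ g, BddBorelNN g →
      (∀ t, |f t - g t| ≤ δ) → |V f - V g| ≤ ε) :
    ∀ lam > (0:ℝ), ∀ ε > (0:ℝ), ∃ δ > (0:ℝ), ∀ f g,
      BddBorelNN f → BddBorelNN g → (∀ t, f t ≤ lam) → (∀ t, g t ≤ lam) →
      (∀ t, |f t - g t| ≤ δ) → |V f - V g| ≤ ε := by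
  intro lam hlam ε hε
  by_contra! hneg
  obtain ⟨C, hC⟩ := valuation_bounded hval hcont hlam.le
  let Q : ℕ → (Metric.sphere (0 : EuclideanSpace ℝ (Fin n)) 1 → ℝ) → Prop := fun m a =>
    Measurable a ∧ (∀ t, 0 ≤ a t) ∧ (∀ t, a t + (2 / 3) ^ m * lam ≤ lam) ∧
      ∀ δ > (0 : ℝ), ∃ h k, ClosePair a ((2 / 3) ^ m * lam) δ h k ∧
        ε / 2 + ε / 2 * (1 / 2) ^ m ≤ V h - V k
  have hQ0 : Q 0 fun _ => 0 := by
    refine ⟨measurable_const, fun _ => le_rfl, fun _ => by simp, fun δ hδ => ?_⟩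
    obtain ⟨f, g, hf, hg, hfl, hgl, hfg, hV⟩ := hneg δ hδ
    rcases lt_abs.1 hV with h | h
    · refine ⟨f, g, ⟨hf, hg, fun t => ⟨hf.2.2 t, by simpa using hfl t⟩,
        fun t => ⟨hg.2.2 t, by simpa using hgl t⟩, hfg⟩, ?_⟩
      rw [pow_zero]
      linarith
    · refine ⟨g, f, ⟨hg, hf, fun t => ⟨hg.2.2 t, by simpa using hgl t⟩,
        fun t => ⟨hf.2.2 t, by simpa using hfl t⟩, fun t => ?_⟩, ?_⟩
      · rw [abs_sub_comm]
        exact hfg t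
      · rw [pow_zero]
        linarith
  have hstep : ∀ m a, Q m a → ∃ b, Q (m + 1) b ∧ (∀ t, a t ≤ b t) ∧
      ∀ t, b t + (2 / 3) ^ (m + 1) * lam ≤ a t + (2 / 3) ^ m * lam := by
    rintro m a ⟨ha, ha0, har, hE⟩
    obtain ⟨b, hb, hab, hba, hbE⟩ := exists_smaller_cells hval hC ha ha0
      (by positivity) har (show 0 < ε / 2 * (1 / 2) ^ (m + 1) by positivity) hE
    have e1 : 2 / 3 * ((2 / 3) ^ m * lam) = (2 / 3) ^ (m + 1) * lam := by ring
    have e2 : ε / 2 + ε / 2 * (1 / 2) ^ m - ε / 2 * (1 / 2) ^ (m + 1)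
        = ε / 2 + ε / 2 * (1 / 2) ^ (m + 1) := by ring
    rw [e1, e2] at hbE
    rw [e1] at hba
    exact ⟨b, ⟨hb, fun t => (ha0 t).trans (hab t), fun t => (hba t).trans (har t), hbE⟩, hab, hba⟩
  choose! F hF using hstep
  let a : ℕ → Metric.sphere (0 : EuclideanSpace ℝ (Fin n)) 1 → ℝ :=
    fun m => Nat.rec (fun _ => 0) F m
  have hQ : ∀ m, Q m (a m) := fun m => by
    induction m with
    | zero => exact hQ0
    | succ m ih => exact (hF m _ ih).1
  have hmono t : Monotone fun m => a m t :=
    monotone_nat_of_le_succ fun m => (hF m _ (hQ m)).2.1 t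
  have hanti t : Antitone fun m => a m t + (2 / 3) ^ m * lam :=
    antitone_nat_of_succ_le fun m => (hF m _ (hQ m)).2.2 t
  have hcross : ∀ t m j, a j t ≤ a m t + (2 / 3) ^ m * lam := fun t m j => by
    have hm : 0 ≤ (2 / 3 : ℝ) ^ m * lam := by positivity
    have hj : 0 ≤ (2 / 3 : ℝ) ^ j * lam := by positivity
    rcases le_total j m with h | h
    · have : a j t ≤ a m t := hmono t h
      linarith
    · have : a j t + (2 / 3) ^ j * lam ≤ a m t + (2 / 3) ^ m * lam := hanti t h
      linarith
  have hle t m : a m t ≤ ⨆ j, a j t :=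
    le_ciSup (f := fun j => a j t) ⟨_, Set.forall_mem_range.2 fun j => hcross t 0 j⟩ m
  have hge t m : ⨆ j, a j t ≤ a m t + (2 / 3) ^ m * lam := ciSup_le fun j => hcross t m j
  have hf : BddBorelNN fun t => ⨆ j, a j t :=
    ⟨Measurable.iSup fun j => (hQ j).1, ⟨lam, fun t => (hge t 0).trans ((hQ 0).2.2.1 t)⟩,
      fun t => ((hQ 0).2.1 t).trans (hle t 0)⟩
  obtain ⟨δ, hδ, hfV⟩ := hcont _ hf (ε / 5) (by positivity)
  obtain ⟨m, hm⟩ := exists_pow_lt_of_lt_one (div_pos hδ hlam) (show (2 / 3 : ℝ) < 1 by norm_num)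
  rw [lt_div_iff₀ hlam] at hm
  obtain ⟨h, k, hhk, hE⟩ := (hQ m).2.2.2 1 one_pos
  have b1 := hfV h hhk.left fun t => by
    have := hhk.left_mem t
    have := hle t m
    have := hge t m
    exact abs_le.2 ⟨by linarith, by linarith⟩
  have b2 := hfV k hhk.right fun t => by
    have := hhk.right_mem t
    have := hle t m
    have := hge t m
    exact abs_le.2 ⟨by linarith, by linarith⟩
  have hpos : 0 < ε / 2 * (1 / 2) ^ m := by positivity
  rw [abs_le] at b1 b2
  linarith
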